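/- Let G be an undirected simple graph on [d], let Σ ∈ ℝ^{d×d} be positive definite with ⟨G⟩^⌉ = ⟦Σ^{-1}⟧, and let X ~ N(0,Σ). Then Σ is Markov perfect w.r.t. G: for all nonempty disjoint subsets A, B ⊆ [d] and every K ⊆ [d]∖(A∪B), K separates A from B in G if and only if X_A and X_B are conditionally independent given X_K. -/

import Mathlib

open MeasureTheory ProbabilityTheory

/-- `S` separates `A` from `B` in the simple graph `G`: every path from a vertex of `A` to a
vertex of `B` passes through a vertex of `S`. -/
def Separates {d : ℕ} (G : SimpleGraph (Fin d)) (A B S : Set (Fin d)) : Prop :=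
  ∀ a ∈ A, ∀ b ∈ B, ∀ p : G.Walk a b, p.IsPath → ∃ c ∈ S, c ∈ p.support

/-- Determinant of the submatrix of `M` with rows indexed by `{i} ∪ K` and columns indexed
by `{j} ∪ K`. -/
noncomputable def subDet {d : ℕ} (M : Matrix (Fin d) (Fin d) ℝ) (i j : Fin d)
    (K : Finset (Fin d)) : ℝ :=
  (M.submatrix (fun k : Option {x // x ∈ K} => k.elim i Subtype.val)
    (fun k : Option {x // x ∈ K} => k.elim j Subtype.val)).det

theorem separates_iff_forall_singleton {d : ℕ} (G : SimpleGraph (Fin d)) (A B S : Set (Fin d)) :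
    Separates G A B S ↔ ∀ a ∈ A, ∀ b ∈ B, Separates G {a} {b} S := by
  simp [Separates]

namespace Matrix

variable {n : Type*} [Fintype n] [DecidableEq n]

/-- A vector supported on `K` whose image under a positive definite matrix vanishes on `K`
is zero. -/
theorem PosDef.eq_zero_of_mulVec_eq_zero_on {S : Matrix n n ℝ} (hS : S.PosDef) {K : Finset n}
    {z : n → ℝ} (hz : ∀ k ∉ K, z k = 0) (hSz : ∀ k ∈ K, (S *ᵥ z) k = 0) : z = 0 := by
  by_contra hne
  have hpos := hS.dotProduct_mulVec_pos hne
  refine hpos.ne' (Finset.sum_eq_zero fun k _ => ?_)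
  by_cases hk : k ∈ K
  · simp [hSz k hk]
  · simp [hz k hk]

/-- The coefficient vector `w` of the residual of the regression of the `b`-th coordinate on the
coordinates in `K`. -/
theorem PosDef.exists_residual {S : Matrix n n ℝ} (hS : S.PosDef) {K : Finset n} {b : n}
    (hb : b ∉ K) :
    ∃ w : n → ℝ, w b = 1 ∧ (∀ k, k ≠ b → k ∉ K → w k = 0) ∧ ∀ k ∈ K, (S *ᵥ w) k = 0 := by
  set T : Matrix K K ℝ := S.submatrix Subtype.val Subtype.val with hT
  have hTpd : T.PosDef := hS.submatrix Subtype.val_injective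
  have hdet : IsUnit T.det := (isUnit_iff_isUnit_det T).1 hTpd.isUnit
  set c : K → ℝ := T⁻¹ *ᵥ (fun k : K => S k b) with hc
  have hTc : T *ᵥ c = fun k : K => S k b := by
    rw [hc, mulVec_mulVec, mul_nonsing_inv _ hdet, one_mulVec]
  refine ⟨fun k => (if k = b then 1 else 0) - if h : k ∈ K then c ⟨k, h⟩ else 0, ?_, ?_, ?_⟩
  · simp [hb]
  · intro k hkb hkK
    simp [hkb, hkK]
  · intro k hk
    have h := congrFun hTc ⟨k, hk⟩
    simp only [mulVec, dotProduct, hT, submatrix_apply] at h ⊢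
    have h1 : ∑ x, S k x * (if h : x ∈ K then c ⟨x, h⟩ else 0) = ∑ x : K, S k x * c x := by
      rw [← Finset.sum_subset (Finset.subset_univ K), ← Finset.sum_coe_sort]
      · simp
      · intro x _ hx
        simp [hx]
    simp only [mul_sub, Finset.sum_sub_distrib, h1, h]
    simp

end Matrix

open Matrix in
theorem subDet_inv_eq_zero_iff {d : ℕ} {S : Matrix (Fin d) (Fin d) ℝ} (hS : S.PosDef)
    {a b : Fin d} (hab : a ≠ b) {K : Finset (Fin d)} (ha : a ∉ K) {w : Fin d → ℝ}
    (hb : b ∉ K) (hwb : w b = 1) (hw : ∀ k, k ≠ b → k ∉ K → w k = 0)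
    (hSw : ∀ k ∈ K, (S *ᵥ w) k = 0) :
    subDet S⁻¹ a b (Finset.univ \ insert a (insert b K)) = 0 ↔ (S *ᵥ w) a = 0 := by
  set L : Finset (Fin d) := Finset.univ \ insert a (insert b K) with hL
  have hLmem (k : Fin d) : k ∈ L ↔ k ≠ a ∧ k ≠ b ∧ k ∉ K := by simp [hL]
  have hdet : IsUnit S.det := (isUnit_iff_isUnit_det S).1 hS.isUnit
  have hsum (i : Fin d) (u : Fin d → ℝ) (hu : ∀ k, k ≠ b → k ∉ L → u k = 0) :
      (S⁻¹ *ᵥ u) i = S⁻¹ i b * u b + ∑ k : L, S⁻¹ i k * u k := by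
    have hbL : b ∉ L := by simp [hLmem]
    rw [mulVec, dotProduct, ← Finset.sum_subset (Finset.subset_univ (insert b L)),
      Finset.sum_insert hbL, ← Finset.sum_coe_sort]
    intro k _ hk
    rw [Finset.mem_insert, not_or] at hk
    rw [hu k hk.1 hk.2, mul_zero]
  rw [subDet, ← exists_mulVec_eq_zero_iff]
  constructor
  · rintro ⟨v, hv, hMv⟩
    set u : Fin d → ℝ := fun k =>
      if k = b then v none else if h : k ∈ L then v (some ⟨k, h⟩) else 0 with hu
    have hub : u b = v none := by simp [hu]
    have huL (k : L) : u k = v (some k) := by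
      have : (k : Fin d) ≠ b := ((hLmem k).1 k.2).2.1
      simp [hu, this]
    have hu0 (k : Fin d) (h1 : k ≠ b) (h2 : k ∉ L) : u k = 0 := by simp [hu, h1, h2]
    have hrow (i : Option L) : (S⁻¹ *ᵥ u) (i.elim a Subtype.val) = 0 := by
      rw [hsum _ u hu0, hub]
      have := congrFun hMv i
      simp only [mulVec, dotProduct, Fintype.sum_option, submatrix_apply] at this
      simpa [huL] using this
    set w' := S⁻¹ *ᵥ u with hw'
    have hSw' : S *ᵥ w' = u := by
      rw [hw', mulVec_mulVec, mul_nonsing_inv _ hdet, one_mulVec]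
    have hw'a : w' a = 0 := hrow none
    have hw'L (k : Fin d) (hk : k ∈ L) : w' k = 0 := hrow (some ⟨k, hk⟩)
    have hz : w' - w' b • w = 0 := by
      refine hS.eq_zero_of_mulVec_eq_zero_on (K := K) (fun k hk => ?_) fun k hk => ?_
      · by_cases hkb : k = b
        · simp [hkb, hwb]
        · have : w' k = 0 := by
            by_cases hka : k = a
            · rw [hka, hw'a]
            · exact hw'L k ((hLmem k).2 ⟨hka, hkb, hk⟩)
          simp [this, hw k hkb hk]
      · have : u k = 0 := hu0 k (fun h => hb (h ▸ hk)) fun h => ((hLmem k).1 h).2.2 hk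
        simp [mulVec_sub, mulVec_smul, hSw', hSw k hk, this]
    have hw'w : w' = w' b • w := sub_eq_zero.1 hz
    have hb0 : w' b ≠ 0 := by
      intro h0
      have h1 : w' = 0 := by rw [hw'w, h0, zero_smul]
      have h2 : u = 0 := by rw [← hSw', h1, mulVec_zero]
      apply hv
      funext i
      cases i with
      | none => rw [← hub, h2]; rfl
      | some k => rw [← huL, h2]; rfl
    have hua : u a = 0 := hu0 a hab fun h => ((hLmem a).1 h).1 rfl
    have : w' b * (S *ᵥ w) a = 0 := by
      have := congrFun hSw' a
      rw [hw'w, mulVec_smul, hua] at this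
      simpa [hwb] using this
    exact (mul_eq_zero.1 this).resolve_left hb0
  · intro hSwa
    set u := S *ᵥ w with hu
    have hSu : S⁻¹ *ᵥ u = w := by
      rw [hu, mulVec_mulVec, nonsing_inv_mul _ hdet, one_mulVec]
    have hu0 (k : Fin d) (h1 : k ≠ b) (h2 : k ∉ L) : u k = 0 := by
      by_cases hk : k ∈ K
      · exact hSw k hk
      · have : k = a := by
          by_contra hka
          exact h2 ((hLmem k).2 ⟨hka, h1, hk⟩)
        rw [this, hSwa]
    refine ⟨fun j => u (j.elim b Subtype.val), fun h0 => ?_, ?_⟩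
    · have hu' : u = 0 := by
        funext k
        by_cases h1 : k = b
        · rw [h1]; exact congrFun h0 none
        · by_cases h2 : k ∈ L
          · exact congrFun h0 (some ⟨k, h2⟩)
          · exact hu0 k h1 h2
      rw [hu', mulVec_zero] at hSu
      simp [← hSu] at hwb
    · funext i
      have h1 := hsum (i.elim a Subtype.val) u hu0
      simp only [mulVec, dotProduct, Fintype.sum_option, submatrix_apply, Pi.zero_apply]
      rw [hSu] at h1
      have h2 : w (i.elim a Subtype.val) = 0 := by
        cases i with
        | none => exact hw a hab ha
        | some k =>
          obtain ⟨_, hkb, hkK⟩ := (hLmem k).1 k.2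
          exact hw k hkb hkK
      rw [h2] at h1
      exact h1.symm

namespace ProbabilityTheory

variable {Ω γ δ E : Type*} {mΩ : MeasurableSpace Ω} {mγ : MeasurableSpace γ}
  {mδ : MeasurableSpace δ} [AddCommGroup E] [MeasurableSpace E] [MeasurableAdd₂ E]
  [MeasurableSub₂ E]

/-- The kernel sending `x` to the translate of the measure `ρ` by `ψ x`. -/
noncomputable def shiftKernel (ρ : Measure E) [SFinite ρ] {ψ : γ → E} (hψ : Measurable ψ) :
    Kernel γ E where
  toFun x := ρ.map fun r => r + ψ x
  measurable' := by
    refine Measure.measurable_of_measurable_coe _ fun s hs => ?_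
    have h (x : γ) : ρ.map (fun r => r + ψ x) s = ρ (Prod.mk x ⁻¹' {p : γ × E | p.2 + ψ p.1 ∈ s}) :=
      Measure.map_apply (by fun_prop) hs
    simp_rw [h]
    exact measurable_measure_prodMk_left
      ((measurable_snd.add (hψ.comp measurable_fst)) hs)

instance (ρ : Measure E) [IsProbabilityMeasure ρ] {ψ : γ → E} (hψ : Measurable ψ) :
    IsMarkovKernel (shiftKernel ρ hψ) :=
  ⟨fun _ => Measure.isProbabilityMeasure_map (by fun_prop)⟩

theorem map_prodMk_add_eq_compProd_shiftKernel_iff {μ : Measure Ω} [IsProbabilityMeasure μ]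
    {h : Ω → γ} (hh : Measurable h) {R : Ω → E} (hR : Measurable R) {ψ : γ → E}
    (hψ : Measurable ψ) [IsProbabilityMeasure (μ.map R)] :
    μ.map (fun ω => (h ω, R ω + ψ (h ω))) = μ.map h ⊗ₘ shiftKernel (μ.map R) hψ ↔
      IndepFun h R μ := by
  let e : γ × E ≃ᵐ γ × E :=
    { toFun := fun p => (p.1, p.2 + ψ p.1)
      invFun := fun p => (p.1, p.2 - ψ p.1)
      left_inv := fun p => by simp
      right_inv := fun p => by simp
      measurable_toFun := by simp only [Equiv.coe_fn_mk]; fun_prop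
      measurable_invFun := by simp only [Equiv.coe_fn_symm_mk]; fun_prop }
  have he : (e : γ × E → γ × E) = fun p => (p.1, p.2 + ψ p.1) := rfl
  have hprob : IsProbabilityMeasure (μ.map h) := Measure.isProbabilityMeasure_map hh.aemeasurable
  have h1 : μ.map (fun ω => (h ω, R ω + ψ (h ω))) = (μ.map fun ω => (h ω, R ω)).map e := by
    rw [Measure.map_map e.measurable (by fun_prop)]
    rfl
  have h2 : μ.map h ⊗ₘ shiftKernel (μ.map R) hψ = ((μ.map h).prod (μ.map R)).map e := by
    ext s hs
    rw [Measure.compProd_apply hs, Measure.map_apply e.measurable hs,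
      Measure.prod_apply (e.measurable hs)]
    refine lintegral_congr fun x => ?_
    change (μ.map R).map (fun r => r + ψ x) (Prod.mk x ⁻¹' s) = _
    rw [Measure.map_apply (by fun_prop) (measurable_prodMk_left hs)]
    rfl
  rw [h1, h2, indepFun_iff_map_prod_eq_prod_map_map hh.aemeasurable hR.aemeasurable]
  exact (MeasurableEquiv.map_measurableEquiv_injective e).eq_iff

theorem condIndepFun_add_comp_iff_indepFun [StandardBorelSpace Ω] [StandardBorelSpace δ]
    [Nonempty δ] [StandardBorelSpace E] {μ : Measure Ω} [IsProbabilityMeasure μ]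
    {k : Ω → γ} (hk : Measurable k) {g : Ω → δ} (hg : Measurable g) {R : Ω → E}
    (hR : Measurable R) {ψ : γ → E} (hψ : Measurable ψ) (hkR : IndepFun k R μ) :
    CondIndepFun (mγ.comap k) hk.comap_le g (fun ω => R ω + ψ (k ω)) μ ↔
      IndepFun (fun ω => (k ω, g ω)) R μ := by
  have hprob : IsProbabilityMeasure (μ.map R) := Measure.isProbabilityMeasure_map hR.aemeasurable
  have hf : Measurable fun ω => R ω + ψ (k ω) := by fun_prop
  have hψ_fst : Measurable fun p : γ × δ => ψ p.1 := by fun_prop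
  have hκ : condDistrib (fun ω => R ω + ψ (k ω)) k μ =ᵐ[μ.map k] shiftKernel (μ.map R) hψ :=
    condDistrib_ae_eq_of_measure_eq_compProd _ hf.aemeasurable
      ((map_prodMk_add_eq_compProd_shiftKernel_iff hk hR hψ).2 hkR)
  have hκ' : (condDistrib (fun ω => R ω + ψ (k ω)) k μ).prodMkRight δ
      =ᵐ[μ.map fun ω => (k ω, g ω)]
        shiftKernel (μ.map R) hψ_fst := by
    have hfst : μ.map k = (μ.map fun ω => (k ω, g ω)).map Prod.fst := by
      rw [Measure.map_map measurable_fst (by fun_prop)]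
      rfl
    rw [hfst] at hκ
    filter_upwards [ae_of_ae_map measurable_fst.aemeasurable hκ] with p hp
    exact hp
  rw [condIndepFun_iff_condDistrib_prod_ae_eq_prodMkRight hf hg hk,
    ← map_prodMk_add_eq_compProd_shiftKernel_iff (by fun_prop) hR hψ_fst,
    ← condDistrib_ae_eq_iff_measure_eq_compProd _ (by exact hf.aemeasurable)]
  exact ⟨fun h => h.trans hκ', fun h => h.trans hκ'.symm⟩

end ProbabilityTheory

namespace ProbabilityTheory

open Matrix

universe u

variable {Ω : Type*} {n : Type u} {mΩ : MeasurableSpace Ω} {μ : Measure Ω} [Fintype n] {X : Ω → n → ℝ}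
  {S : Matrix n n ℝ}

theorem hasGaussianLaw_of_forall_map_sum_eq_gaussianReal (hX : Measurable X)
    (hGauss : ∀ l : n → ℝ, μ.map (fun ω => ∑ k, l k * X ω k) =
      gaussianReal 0 (Real.toNNReal (∑ i, ∑ j, l i * S i j * l j))) :
    HasGaussianLaw X μ where
  isGaussian_map := by
    classical
    refine isGaussian_of_map_eq_gaussianReal fun L => ⟨0, Real.toNNReal
      (∑ i, ∑ j, L (Pi.single i 1) * S i j * L (Pi.single j 1)), ?_⟩
    rw [Measure.map_map L.measurable hX, ← hGauss fun k => L (Pi.single k 1)]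
    congr 1
    funext ω
    have h := LinearMap.pi_apply_eq_sum_univ (L : (n → ℝ) →ₗ[ℝ] ℝ) (X ω)
    simp only [ContinuousLinearMap.coe_coe, smul_eq_mul] at h
    rw [Function.comp_apply, h]
    refine Finset.sum_congr rfl fun k _ => ?_
    rw [mul_comm]
    congr 2
    funext j
    simp [Pi.single_apply, eq_comm]

theorem variance_sum_mul_eq_of_map_eq_gaussianReal (hX : Measurable X) (hS : S.PosSemidef)
    (hGauss : ∀ l : n → ℝ, μ.map (fun ω => ∑ k, l k * X ω k) =
      gaussianReal 0 (Real.toNNReal (∑ i, ∑ j, l i * S i j * l j))) (l : n → ℝ) :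
    Var[fun ω => ∑ k, l k * X ω k; μ] = l ⬝ᵥ S *ᵥ l := by
  have hl : ∑ i, ∑ j, l i * S i j * l j = l ⬝ᵥ S *ᵥ l := by
    simp [dotProduct, mulVec, Finset.mul_sum, mul_assoc]
  rw [← variance_id_map (by fun_prop), hGauss, variance_id_gaussianReal, hl, Real.coe_toNNReal]
  simpa using hS.dotProduct_mulVec_nonneg l

theorem HasGaussianLaw.memLp_two_sum_mul (hXG : HasGaussianLaw X μ) (l : n → ℝ) :
    MemLp (fun ω => ∑ k, l k * X ω k) 2 μ :=
  memLp_finsetSum _ fun k _ => (hXG.eval k).memLp_two.const_mul (l k)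

theorem covariance_sum_mul_eq_of_map_eq_gaussianReal (hX : Measurable X) (hS : S.PosSemidef)
    (hGauss : ∀ l : n → ℝ, μ.map (fun ω => ∑ k, l k * X ω k) =
      gaussianReal 0 (Real.toNNReal (∑ i, ∑ j, l i * S i j * l j))) (l m : n → ℝ) :
    cov[fun ω => ∑ k, l k * X ω k, fun ω => ∑ k, m k * X ω k; μ] = l ⬝ᵥ S *ᵥ m := by
  have hXG := hasGaussianLaw_of_forall_map_sum_eq_gaussianReal hX hGauss
  have := hXG.isProbabilityMeasure
  have hadd := variance_fun_add (hXG.memLp_two_sum_mul l) (hXG.memLp_two_sum_mul m)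
  have hlm : (fun ω => ∑ k, l k * X ω k + ∑ k, m k * X ω k) =
      fun ω => ∑ k, (l + m) k * X ω k := by
    funext ω
    simp [add_mul, Finset.sum_add_distrib]
  have hsymm : m ⬝ᵥ S *ᵥ l = l ⬝ᵥ S *ᵥ m := by
    rw [dotProduct_mulVec, dotProduct_comm, ← mulVec_transpose,
      show Sᵀ = S by simpa using hS.isHermitian.eq]
  rw [hlm] at hadd
  simp only [variance_sum_mul_eq_of_map_eq_gaussianReal hX hS hGauss, mulVec_add,
    dotProduct_add, add_dotProduct, hsymm] at hadd
  linarith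

theorem indepFun_sum_mul_of_dotProduct_eq_zero {ι κ : Type*} [Finite ι] [Finite κ]
    (hX : Measurable X) (hS : S.PosSemidef)
    (hGauss : ∀ l : n → ℝ, μ.map (fun ω => ∑ k, l k * X ω k) =
      gaussianReal 0 (Real.toNNReal (∑ i, ∑ j, l i * S i j * l j)))
    {l : ι → n → ℝ} {m : κ → n → ℝ} (h : ∀ i j, l i ⬝ᵥ S *ᵥ m j = 0) :
    IndepFun (fun ω i => ∑ k, l i k * X ω k) (fun ω j => ∑ k, m j k * X ω k) μ := by
  have := Fintype.ofFinite ι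
  have := Fintype.ofFinite κ
  refine HasGaussianLaw.indepFun_of_covariance_eval
    (X := fun i ω => ∑ k, l i k * X ω k) (Y := fun j ω => ∑ k, m j k * X ω k) ?_ fun i j => ?_
  · exact (hasGaussianLaw_of_forall_map_sum_eq_gaussianReal hX hGauss).map_fun
      (((LinearMap.prod (Matrix.mulVecLin (Matrix.of l)) (Matrix.mulVecLin (Matrix.of m))) :
        (n → ℝ) →ₗ[ℝ] (ι → ℝ) × (κ → ℝ)).toContinuousLinearMap)
  · rw [covariance_sum_mul_eq_of_map_eq_gaussianReal hX hS hGauss, h]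

/-- For a centred Gaussian vector `X` with covariance `S`, conditional independence of `X_A` and
`X_B` given `X_K` is equivalent to the orthogonality of `X_A` and the residuals `⟨w b, X⟩` of the
regression of `X_B` on `X_K`. -/
theorem condIndepFun_iff_forall_mulVec_residual_eq_zero [StandardBorelSpace Ω] [DecidableEq n]
    (hX : Measurable X) (hS : S.PosSemidef)
    (hGauss : ∀ l : n → ℝ, μ.map (fun ω => ∑ k, l k * X ω k) =
      gaussianReal 0 (Real.toNNReal (∑ i, ∑ j, l i * S i j * l j)))
    {A B K : Finset n} (hBK : ∀ b ∈ B, b ∉ K) [IsProbabilityMeasure μ]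
    {w : n → n → ℝ} (hwb : ∀ b ∈ B, w b b = 1)
    (hw : ∀ b ∈ B, ∀ k, k ≠ b → k ∉ K → w b k = 0)
    (hSw : ∀ b ∈ B, ∀ k ∈ K, (S *ᵥ w b) k = 0)
    (hK : Measurable fun ω (k : K) => X ω k) :
    CondIndepFun (MeasurableSpace.comap (fun ω (k : K) => X ω k) inferInstance) hK.comap_le
        (fun ω (a : A) => X ω a) (fun ω (b : B) => X ω b) μ ↔
      ∀ a ∈ A, ∀ b ∈ B, (S *ᵥ w b) a = 0 := by
  have hXG := hasGaussianLaw_of_forall_map_sum_eq_gaussianReal hX hGauss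
  set R : Ω → B → ℝ := fun ω b => ∑ k, w b k * X ω k with hR
  set ψ : (K → ℝ) → B → ℝ := fun x b => -∑ k : K, w b k * x k with hψ
  have hRm : Measurable R := by fun_prop
  have hψm : Measurable ψ := by fun_prop
  have hXB : (fun ω (b : B) => X ω b) = fun ω => R ω + ψ fun k : K => X ω k := by
    funext ω b
    have : ∑ k, w b k * X ω k = X ω b + ∑ k : K, w b k * X ω k := by
      rw [← Finset.sum_subset (Finset.subset_univ (insert (b : n) K)),
        Finset.sum_insert (hBK b b.2), hwb b b.2, one_mul,
        ← Finset.sum_coe_sort K fun k => w b k * X ω k]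
      intro k _ hk
      rw [Finset.mem_insert, not_or] at hk
      rw [hw b b.2 k hk.1 hk.2, zero_mul]
    simp [hR, hψ, this]
  have hsingle (k : n) : (fun ω => X ω k) = fun ω => ∑ j, (Pi.single k 1 : n → ℝ) j * X ω j := by
    funext ω
    simp [Pi.single_apply]
  have hindep {ι : Type u} [Finite ι] (f : ι → n) (hf : ∀ i, ∀ b ∈ B, (S *ᵥ w b) (f i) = 0) :
      IndepFun (fun ω i => X ω (f i)) R μ := by
    have := indepFun_sum_mul_of_dotProduct_eq_zero hX hS hGauss
      (l := fun i => Pi.single (f i) 1) (m := fun b : B => w b)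
      fun i b => by simpa using hf i b b.2
    simpa [Pi.single_apply] using this
  have hkR : IndepFun (fun ω (k : K) => X ω k) R μ :=
    hindep Subtype.val fun k b hb => hSw b hb k k.2
  rw [hXB, condIndepFun_add_comp_iff_indepFun hK (by fun_prop) hRm hψm hkR]
  constructor
  · intro h a ha b hb
    have hab : IndepFun (fun ω => X ω a) (fun ω => ∑ k, w b k * X ω k) μ :=
      h.comp (φ := fun p : (K → ℝ) × (A → ℝ) => p.2 ⟨a, ha⟩) (ψ := fun r : B → ℝ => r ⟨b, hb⟩)
        (by fun_prop) (by fun_prop)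
    rw [hsingle a] at hab
    have hcov := hab.covariance_eq_zero (hXG.memLp_two_sum_mul _) (hXG.memLp_two_sum_mul _)
    rw [covariance_sum_mul_eq_of_map_eq_gaussianReal hX hS hGauss] at hcov
    simpa using hcov
  · intro h
    have hKA : IndepFun (fun ω (i : K ⊕ A) => X ω (Sum.elim Subtype.val Subtype.val i)) R μ := by
      refine hindep _ fun i b hb => ?_
      rcases i with k | a
      · exact hSw b hb k k.2
      · exact h a a.2 b hb
    exact hKA.comp (φ := fun x => (fun k => x (Sum.inl k), fun a => x (Sum.inr a)))
      (by fun_prop) measurable_id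

end ProbabilityTheory


/-- let `G` be a simple graph on `[d]`, `Σ` positive definite with
`⟨G⟩^⌉ = ⟦Σ⁻¹⟧` (i.e. for all distinct `i,j` and `K ⊆ [d] ∖ {i,j}`,
`det (Σ⁻¹)_{iK,jK} = 0` iff `[d] ∖ ({i,j} ∪ K)` separates `{i}` from `{j}` in `G`), and let
`X ~ N(0,Σ)` (encoded by: every linear functional `⟨l, X⟩` has law `N(0, lᵀΣl)`). Then `Σ`
is Markov perfect w.r.t. `G`: for all nonempty disjoint `A, B ⊆ [d]` and every
`K ⊆ [d] ∖ (A ∪ B)`, `K` separates `A` from `B` in `G` iff `X_A` and `X_B` are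
conditionally independent given the σ-algebra generated by `X_K`. -/
theorem statement11 {d : ℕ} {Ω : Type*} [MeasureSpace Ω] [StandardBorelSpace Ω]
    [IsProbabilityMeasure (ℙ : Measure Ω)]
    (G : SimpleGraph (Fin d))
    (Sig : Matrix (Fin d) (Fin d) ℝ) (hSig : Sig.PosDef)
    (hdual : ∀ i j : Fin d, i ≠ j → ∀ K : Finset (Fin d), i ∉ K → j ∉ K →
      (subDet (Sig⁻¹) i j K = 0 ↔
        Separates G {i} {j} ↑(Finset.univ \ insert i (insert j K))))
    (X : Ω → Fin d → ℝ) (hX : Measurable X)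
    (hGauss : ∀ l : Fin d → ℝ,
      Measure.map (fun ω => ∑ k, l k * X ω k) ℙ =
        gaussianReal 0 (Real.toNNReal (∑ i, ∑ j, l i * Sig i j * l j))) :
    ∀ A B : Finset (Fin d), A.Nonempty → B.Nonempty → Disjoint A B →
      ∀ K : Finset (Fin d), Disjoint K (A ∪ B) →
      (Separates G ↑A ↑B ↑K ↔
        CondIndepFun
          (MeasurableSpace.comap (fun ω (k : {x // x ∈ K}) => X ω (k : Fin d)) inferInstance)
          (Measurable.comap_le (by fun_prop))
          (fun ω (a : {x // x ∈ A}) => X ω (a : Fin d))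
          (fun ω (b : {x // x ∈ B}) => X ω (b : Fin d)) ℙ) := by
  intro A B _ _ hAB K hK
  have hBK : ∀ b ∈ B, b ∉ K := fun b hb hbK =>
    Finset.disjoint_left.1 hK hbK (Finset.mem_union_right A hb)
  have hAK : ∀ a ∈ A, a ∉ K := fun a ha haK =>
    Finset.disjoint_left.1 hK haK (Finset.mem_union_left B ha)
  have hres (b : Fin d) : ∃ w : Fin d → ℝ, b ∉ K →
      w b = 1 ∧ (∀ k, k ≠ b → k ∉ K → w k = 0) ∧ ∀ k ∈ K, (Sig.mulVec w) k = 0 := by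
    by_cases hb : b ∈ K
    · exact ⟨0, fun h => absurd hb h⟩
    · obtain ⟨w, hw⟩ := hSig.exists_residual hb
      exact ⟨w, fun _ => hw⟩
  choose w hw using hres
  rw [condIndepFun_iff_forall_mulVec_residual_eq_zero hX hSig.posSemidef hGauss hBK
    (fun b hb => (hw b (hBK b hb)).1) (fun b hb => (hw b (hBK b hb)).2.1)
    (fun b hb => (hw b (hBK b hb)).2.2) (measurable_pi_lambda _ fun k => by fun_prop),
    separates_iff_forall_singleton]
  refine forall₂_congr fun a ha => forall₂_congr fun b hb => ?_
  have ha : a ∈ A := ha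
  have hb : b ∈ B := hb
  have hab : a ≠ b := fun h => Finset.disjoint_left.1 hAB ha (h ▸ hb)
  obtain ⟨hwb, hw0, hSw⟩ := hw b (hBK b hb)
  have hcompl : Finset.univ \ insert a (insert b (Finset.univ \ insert a (insert b K))) = K := by
    ext k
    have h1 : k ∈ K → k ≠ a := fun h h' => hAK a ha (h' ▸ h)
    have h2 : k ∈ K → k ≠ b := fun h h' => hBK b hb (h' ▸ h)
    simp only [Finset.mem_sdiff, Finset.mem_univ, Finset.mem_insert, true_and]
    tauto
  rw [← subDet_inv_eq_zero_iff hSig hab (hAK a ha) (hBK b hb) hwb hw0 hSw,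
    hdual a b hab _ (by simp) (by simp), hcompl]
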